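/- Fifth-order exactness of the one-sided split linear weights: let Δξ > 0, let ξ_1, …, ξ_5 be equispaced nodes with spacing Δξ, let κ = (1/2)√(3/5), fix real values U_1, …, U_5, let P_0, P_1, P_2 be the quadratic interpolants of these values on the stencils {ξ_1, ξ_2, ξ_3}, {ξ_2, ξ_3, ξ_4}, {ξ_3, ξ_4, ξ_5}, and let Q be the quartic interpolant of all five values on {ξ_1, …, ξ_5}. Then for each of the four evaluation points ξ_p ∈ {ξ_1 − κΔξ, ξ_1 + κΔξ, ξ_2 − κΔξ, ξ_2 + κΔξ} (with p = 1−κ, 1+κ, 2−κ, 2+κ respectively), and with the constants listed in the context, δ̃_p · (d̃_{0,p} P_0(ξ_p) + d̃_{1,p} P_1(ξ_p) + d̃_{2,p} P_2(ξ_p)) − δ̂_p · (d̂_{0,p} P_0(ξ_p) + d̂_{1,p} P_1(ξ_p) + d̂_{2,p} P_2(ξ_p)) = Q(ξ_p). In particular, when the three smoothness indicators coincide the one-sided Ai-WENO-Z interpolation reproduces the full five-point quartic interpolant, i.e., it is fifth-order accurate. -/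

import Mathlib

/-- Newton's forward difference formula for a polynomial of degree at most two. -/
theorem Polynomial.eval_add_mul_of_degree_le_two {P : Polynomial ℝ} (hP : P.degree ≤ 2)
    (x h t : ℝ) :
    P.eval (x + t * h) = (t - 1) * (t - 2) / 2 * P.eval x - t * (t - 2) * P.eval (x + h)
      + t * (t - 1) / 2 * P.eval (x + 2 * h) := by
  have hn : P.natDegree < 3 := Nat.lt_succ_of_le (natDegree_le_of_degree_le hP)
  simp only [eval_eq_sum_range' hn, Finset.sum_range_succ, Finset.sum_range_zero]
  ring

/-- Lagrange's formula on five equispaced nodes for a polynomial of degree at most four. -/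
theorem Polynomial.eval_add_mul_of_degree_le_four {P : Polynomial ℝ} (hP : P.degree ≤ 4)
    (x h t : ℝ) :
    P.eval (x + t * h) = (t - 1) * (t - 2) * (t - 3) * (t - 4) / 24 * P.eval x
      - t * (t - 2) * (t - 3) * (t - 4) / 6 * P.eval (x + h)
      + t * (t - 1) * (t - 3) * (t - 4) / 4 * P.eval (x + 2 * h)
      - t * (t - 1) * (t - 2) * (t - 4) / 6 * P.eval (x + 3 * h)
      + t * (t - 1) * (t - 2) * (t - 3) / 24 * P.eval (x + 4 * h) := by
  have hn : P.natDegree < 5 := Nat.lt_succ_of_le (natDegree_le_of_degree_le hP)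
  simp only [eval_eq_sum_range' hn, Finset.sum_range_succ, Finset.sum_range_zero]
  ring

/-- The quartic interpolant on five equispaced nodes is a combination of the three quadratic
interpolants on consecutive nodes, with weights depending on the relative position `t`. -/
theorem quartic_interpolant_eq_combination {x h : ℝ} {P₀ P₁ P₂ Q : Polynomial ℝ}
    (hP₀ : P₀.degree ≤ 2) (hP₁ : P₁.degree ≤ 2) (hP₂ : P₂.degree ≤ 2) (hQ : Q.degree ≤ 4)
    (h₀₁ : P₀.eval x = Q.eval x) (h₀₂ : P₀.eval (x + h) = Q.eval (x + h))
    (h₀₃ : P₀.eval (x + 2 * h) = Q.eval (x + 2 * h))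
    (h₁₂ : P₁.eval (x + h) = Q.eval (x + h))
    (h₁₃ : P₁.eval (x + 2 * h) = Q.eval (x + 2 * h))
    (h₁₄ : P₁.eval (x + 3 * h) = Q.eval (x + 3 * h))
    (h₂₃ : P₂.eval (x + 2 * h) = Q.eval (x + 2 * h))
    (h₂₄ : P₂.eval (x + 3 * h) = Q.eval (x + 3 * h))
    (h₂₅ : P₂.eval (x + 4 * h) = Q.eval (x + 4 * h)) (t : ℝ) :
    Q.eval (x + t * h) = (t - 3) * (t - 4) / 12 * P₀.eval (x + t * h)
      + t * (4 - t) / 6 * P₁.eval (x + t * h)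
      + t * (t - 1) / 12 * P₂.eval (x + t * h) := by
  have e₁ := Polynomial.eval_add_mul_of_degree_le_two hP₁ (x + h) h (t - 1)
  have e₂ := Polynomial.eval_add_mul_of_degree_le_two hP₂ (x + 2 * h) h (t - 2)
  rw [show x + h + (t - 1) * h = x + t * h by ring, show x + h + h = x + 2 * h by ring,
    show x + h + 2 * h = x + 3 * h by ring, h₁₂, h₁₃, h₁₄] at e₁
  rw [show x + 2 * h + (t - 2) * h = x + t * h by ring,
    show x + 2 * h + h = x + 3 * h by ring,
    show x + 2 * h + 2 * h = x + 4 * h by ring, h₂₃, h₂₄, h₂₅] at e₂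
  rw [Polynomial.eval_add_mul_of_degree_le_four hQ,
    Polynomial.eval_add_mul_of_degree_le_two hP₀, e₁, e₂, h₀₁, h₀₂, h₀₃]
  ring

/-- Fifth-order exactness of the one-sided split linear weights: with equispaced
nodes `ξ_m = x1 + (m-1)Δξ`, values `U1, …, U5`, quadratic interpolants `P0, P1, P2`
on the one-sided substencils and quartic interpolant `Q` on all five nodes, and
with the split linear weights `d̃`, `d̂` and splitting scalars `δ̃`, `δ̂` of the
one-sided Ai-WENO-Z interpolation (suffixes `a, b, c, e` for the evaluation points
`ξ1 - κΔξ`, `ξ1 + κΔξ`, `ξ2 - κΔξ`, `ξ2 + κΔξ`), one has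
`δ̃(d̃0 P0 + d̃1 P1 + d̃2 P2) - δ̂(d̂0 P0 + d̂1 P1 + d̂2 P2) = Q`
at each of the four points. -/
theorem one_sided_split_linear_weights_exactness
    (Δξ x1 : ℝ) (hΔ : 0 < Δξ) (κ : ℝ) (hκ : κ = 1 / 2 * Real.sqrt (3 / 5))
    (U1 U2 U3 U4 U5 : ℝ) (P0 P1 P2 Q : Polynomial ℝ)
    (hP0 : P0.degree ≤ 2 ∧ P0.eval x1 = U1 ∧ P0.eval (x1 + Δξ) = U2 ∧
      P0.eval (x1 + 2 * Δξ) = U3)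
    (hP1 : P1.degree ≤ 2 ∧ P1.eval (x1 + Δξ) = U2 ∧ P1.eval (x1 + 2 * Δξ) = U3 ∧
      P1.eval (x1 + 3 * Δξ) = U4)
    (hP2 : P2.degree ≤ 2 ∧ P2.eval (x1 + 2 * Δξ) = U3 ∧ P2.eval (x1 + 3 * Δξ) = U4 ∧
      P2.eval (x1 + 4 * Δξ) = U5)
    (hQ : Q.degree ≤ 4 ∧ Q.eval x1 = U1 ∧ Q.eval (x1 + Δξ) = U2 ∧
      Q.eval (x1 + 2 * Δξ) = U3 ∧ Q.eval (x1 + 3 * Δξ) = U4 ∧ Q.eval (x1 + 4 * Δξ) = U5)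
    (td0a td1a td2a td0b td1b td2b td0c td1c td2c td0e td1e td2e : ℝ)
    (hd0a hd1a hd2a hd0b hd1b hd2b hd0c hd1c hd2c hd0e hd1e hd2e : ℝ)
    (dlta dltb dltc dlte dlha dlhb dlhc dlhe : ℝ)
    (h1 : td0a = (18489 - 782 * Real.sqrt 15) / 17787)
    (h2 : td1a = (-711 + 640 * Real.sqrt 15) / 17787)
    (h3 : td2a = (9 + 142 * Real.sqrt 15) / 17787)
    (h4 : td0b = (77142 - 5368 * Real.sqrt 15) / 73767)
    (h5 : td1b = (-2844 + 5048 * Real.sqrt 15) / 73767)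
    (h6 : td2b = (-531 + 320 * Real.sqrt 15) / 73767)
    (h7 : td0c = (38022 + 2648 * Real.sqrt 15) / 73767)
    (h8 : td1c = (36276 - 2968 * Real.sqrt 15) / 73767)
    (h9 : td2c = (-531 + 320 * Real.sqrt 15) / 73767)
    (h10 : td0e = (123 - 10 * Real.sqrt 15) / 240)
    (h11 : td1e = (57 + 4 * Real.sqrt 15) / 120)
    (h12 : td2e = (3 + 2 * Real.sqrt 15) / 240)
    (h13 : hd0a = (8769 - 1342 * Real.sqrt 15) / 5334)
    (h14 : hd1a = (-1662 + 640 * Real.sqrt 15) / 2667)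
    (h15 : hd2a = (-111 + 62 * Real.sqrt 15) / 5334)
    (h16 : hd0b = (19131 - 1564 * Real.sqrt 15) / 17607)
    (h17 : hd1b = (-942 + 1244 * Real.sqrt 15) / 17607)
    (h18 : hd2b = (-582 + 320 * Real.sqrt 15) / 17607)
    (h19 : hd0c = (9171 + 524 * Real.sqrt 15) / 17607)
    (h20 : hd1c = (9018 - 844 * Real.sqrt 15) / 17607)
    (h21 : hd2c = (-582 + 320 * Real.sqrt 15) / 17607)
    (h22 : hd0e = 0) (h23 : hd1e = 0) (h24 : hd2e = 0)
    (h25 : dlta = (83 + 8 * Real.sqrt 15) / 40)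
    (h26 : dltb = (157 + 2 * Real.sqrt 15) / 80)
    (h27 : dltc = (157 + 2 * Real.sqrt 15) / 80)
    (h28 : dlte = 1)
    (h29 : dlha = (43 + 8 * Real.sqrt 15) / 40)
    (h30 : dlhb = (77 + 2 * Real.sqrt 15) / 80)
    (h31 : dlhc = (77 + 2 * Real.sqrt 15) / 80)
    (h32 : dlhe = 0) :
    -- p = 1-κ, evaluation point ξ1 - κΔξ
    (dlta * (td0a * P0.eval (x1 - κ * Δξ) + td1a * P1.eval (x1 - κ * Δξ)
          + td2a * P2.eval (x1 - κ * Δξ))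
        - dlha * (hd0a * P0.eval (x1 - κ * Δξ) + hd1a * P1.eval (x1 - κ * Δξ)
          + hd2a * P2.eval (x1 - κ * Δξ))
      = Q.eval (x1 - κ * Δξ)) ∧
    -- p = 1+κ, evaluation point ξ1 + κΔξ
    (dltb * (td0b * P0.eval (x1 + κ * Δξ) + td1b * P1.eval (x1 + κ * Δξ)
          + td2b * P2.eval (x1 + κ * Δξ))
        - dlhb * (hd0b * P0.eval (x1 + κ * Δξ) + hd1b * P1.eval (x1 + κ * Δξ)
          + hd2b * P2.eval (x1 + κ * Δξ))
      = Q.eval (x1 + κ * Δξ)) ∧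
    -- p = 2-κ, evaluation point ξ2 - κΔξ
    (dltc * (td0c * P0.eval (x1 + Δξ - κ * Δξ) + td1c * P1.eval (x1 + Δξ - κ * Δξ)
          + td2c * P2.eval (x1 + Δξ - κ * Δξ))
        - dlhc * (hd0c * P0.eval (x1 + Δξ - κ * Δξ) + hd1c * P1.eval (x1 + Δξ - κ * Δξ)
          + hd2c * P2.eval (x1 + Δξ - κ * Δξ))
      = Q.eval (x1 + Δξ - κ * Δξ)) ∧
    -- p = 2+κ, evaluation point ξ2 + κΔξ
    (dlte * (td0e * P0.eval (x1 + Δξ + κ * Δξ) + td1e * P1.eval (x1 + Δξ + κ * Δξ)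
          + td2e * P2.eval (x1 + Δξ + κ * Δξ))
        - dlhe * (hd0e * P0.eval (x1 + Δξ + κ * Δξ) + hd1e * P1.eval (x1 + Δξ + κ * Δξ)
          + hd2e * P2.eval (x1 + Δξ + κ * Δξ))
      = Q.eval (x1 + Δξ + κ * Δξ)) := by
  obtain ⟨dP0, a1, a2, a3⟩ := hP0
  obtain ⟨dP1, b2, b3, b4⟩ := hP1
  obtain ⟨dP2, c3, c4, c5⟩ := hP2
  obtain ⟨dQ, q1, q2, q3, q4, q5⟩ := hQ
  have key := quartic_interpolant_eq_combination dP0 dP1 dP2 dQ (a1.trans q1.symm)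
    (a2.trans q2.symm) (a3.trans q3.symm) (b2.trans q2.symm) (b3.trans q3.symm)
    (b4.trans q4.symm) (c3.trans q3.symm) (c4.trans q4.symm) (c5.trans q5.symm)
  have hsq : Real.sqrt 15 ^ 2 = 15 := Real.sq_sqrt (by norm_num)
  have hκ' : κ = Real.sqrt 15 / 10 := by
    rw [hκ, show (3 / 5 : ℝ) = 15 / 5 ^ 2 by norm_num, Real.sqrt_div (by norm_num),
      Real.sqrt_sq (by norm_num)]
    ring
  have combine : ∀ {t ξ δ δ' d₀ d₁ d₂ d₀' d₁' d₂' : ℝ}, ξ = x1 + t * Δξ →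
      δ * d₀ - δ' * d₀' = (t - 3) * (t - 4) / 12 → δ * d₁ - δ' * d₁' = t * (4 - t) / 6 →
      δ * d₂ - δ' * d₂' = t * (t - 1) / 12 →
      δ * (d₀ * P0.eval ξ + d₁ * P1.eval ξ + d₂ * P2.eval ξ)
        - δ' * (d₀' * P0.eval ξ + d₁' * P1.eval ξ + d₂' * P2.eval ξ) = Q.eval ξ := by
    intro t ξ δ δ' d₀ d₁ d₂ d₀' d₁' d₂' hξ w₀ w₁ w₂
    rw [hξ, key t, ← w₀, ← w₁, ← w₂]
    ring
  refine ⟨combine (t := -κ) (by ring) ?_ ?_ ?_, combine (t := κ) rfl ?_ ?_ ?_,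
    combine (t := 1 - κ) (by ring) ?_ ?_ ?_, combine (t := 1 + κ) (by ring) ?_ ?_ ?_⟩ <;>
  subst_vars <;> rw [hκ'] <;> ring_nf <;> rw [hsq] <;> ring
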